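/- Let (X₁, *₁) and (X₂, *₂) be sets with binary operations and let h : X₁ → X₂ satisfy h(x *₁ y) = h(x) *₂ h(y) for all x, y ∈ X₁. For an inclusion hyperspace 𝒜 on X₁ define Gh(𝒜) = {B ⊆ X₂ : h(A) ⊆ B for some A ∈ 𝒜}, which is an inclusion hyperspace on X₂. Then Gh is a homomorphism with respect to the induced operations: Gh(𝒰 ∘₁ 𝒱) = Gh(𝒰) ∘₂ Gh(𝒱) for all inclusion hyperspaces 𝒰, 𝒱 on X₁. -/

import Mathlib

variable {X₁ X₂ : Type*}

/-- An inclusion hyperspace on a set `X`. -/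
def IsIH {X : Type*} (𝒜 : Set (Set X)) : Prop :=
  𝒜.Nonempty ∧ (∀ A ∈ 𝒜, A.Nonempty) ∧ ∀ A ∈ 𝒜, ∀ B : Set X, A ⊆ B → B ∈ 𝒜

/-- The operation on inclusion hyperspaces induced by a binary operation on `X`. -/
def circ {X : Type*} (op : X → X → X) (𝒰 𝒱 : Set (Set X)) : Set (Set X) :=
  {A | {x | {y | op x y ∈ A} ∈ 𝒱} ∈ 𝒰}

/-- The inclusion hyperspace induced by a map `h : X₁ → X₂`. -/
def Gmap (h : X₁ → X₂) (𝒜 : Set (Set X₁)) : Set (Set X₂) :=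
  {B | ∃ A ∈ 𝒜, h '' A ⊆ B}

theorem mem_Gmap_iff {h : X₁ → X₂} {𝒜 : Set (Set X₁)}
    (mono : ∀ A ∈ 𝒜, ∀ B : Set X₁, A ⊆ B → B ∈ 𝒜) {B : Set X₂} :
    B ∈ Gmap h 𝒜 ↔ h ⁻¹' B ∈ 𝒜 :=
  ⟨fun ⟨A, hA, hAB⟩ => mono A hA _ (Set.image_subset_iff.mp hAB),
    fun hB => ⟨_, hB, Set.image_preimage_subset h B⟩⟩

theorem circ_mono {X : Type*} (op : X → X → X) {𝒰 𝒱 : Set (Set X)}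
    (h𝒰 : ∀ A ∈ 𝒰, ∀ B : Set X, A ⊆ B → B ∈ 𝒰)
    (h𝒱 : ∀ A ∈ 𝒱, ∀ B : Set X, A ⊆ B → B ∈ 𝒱) :
    ∀ A ∈ circ op 𝒰 𝒱, ∀ B : Set X, A ⊆ B → B ∈ circ op 𝒰 𝒱 :=
  fun _ hA _ hAB => h𝒰 _ hA _ fun _ hx => h𝒱 _ hx _ fun _ hy => hAB hy

theorem stmt5 (op₁ : X₁ → X₁ → X₁) (op₂ : X₂ → X₂ → X₂) (h : X₁ → X₂)
    (hhom : ∀ x y : X₁, h (op₁ x y) = op₂ (h x) (h y))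
    (𝒰 𝒱 : Set (Set X₁)) (h𝒰 : IsIH 𝒰) (h𝒱 : IsIH 𝒱) :
    Gmap h (circ op₁ 𝒰 𝒱) = circ op₂ (Gmap h 𝒰) (Gmap h 𝒱) := by
  ext B
  rw [mem_Gmap_iff (circ_mono op₁ h𝒰.2.2 h𝒱.2.2)]
  simp only [circ, Set.mem_ofPred_eq, mem_Gmap_iff h𝒰.2.2, mem_Gmap_iff h𝒱.2.2,
    Set.preimage_ofPred_eq, Set.mem_preimage, hhom]
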